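/- arXiv:2111.14417 — 2 statements merged into one kernel-verified Lean document; each statement's English description precedes it below -/
import Mathlib

section
/- For every Condorcet-consistent social decision rule C and every profile R, the nice set is contained in the set of Condorcet winners: N_C(R) ⊆ CW(R); in particular, if N_C(R) ≠ ∅ then CW(R) ≠ ∅. -/
/-- A weak order on `A`: a complete (total) and transitive binary relation. -/
structure WeakOrd (A : Type*) where
  rel : A → A → Prop
  total : ∀ x y, rel x y ∨ rel y x
  trans : ∀ x y z, rel x y → rel y z → rel x z

namespace WeakOrd

variable {A : Type*}

/-- Strict preference. -/
def strict (r : WeakOrd A) (x y : A) : Prop := r.rel x y ∧ ¬ r.rel y x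

/-- Indifference. -/
def indiff (r : WeakOrd A) (x y : A) : Prop := r.rel x y ∧ r.rel y x

open Classical in
/-- The weak order obtained from `r` by moving `x` and `y` strictly above all other
alternatives, preserving the relative ranking of `x` and `y` and of the rest. -/
noncomputable def topShift (r : WeakOrd A) (x y : A) : WeakOrd A where
  rel a b :=
    if a = x ∨ a = y then (if b = x ∨ b = y then r.rel a b else True)
    else if b = x ∨ b = y then False else r.rel a b
  total := by
    intro a b
    by_cases ha : a = x ∨ a = y <;> by_cases hb : b = x ∨ b = y <;>
      simp [ha, hb, r.total a b]
  trans := by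
    intro a b c hab hbc
    by_cases ha : a = x ∨ a = y <;> by_cases hb : b = x ∨ b = y <;>
      by_cases hc : c = x ∨ c = y <;> simp_all <;>
      exact r.trans _ _ _ hab hbc

/-- Relabelling the alternatives of a weak order by a permutation `σ`:
`a` is weakly preferred to `b` in `σ(r)` iff `σ⁻¹ a` is weakly preferred to `σ⁻¹ b` in `r`. -/
def map (σ : Equiv.Perm A) (r : WeakOrd A) : WeakOrd A where
  rel a b := r.rel (σ.symm a) (σ.symm b)
  total := fun _ _ => r.total _ _
  trans := fun _ _ _ hab hbc => r.trans _ _ _ hab hbc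

end WeakOrd

/-- A (preference) profile: a weak order for each voter. -/
abbrev Profile (N A : Type*) := N → WeakOrd A

namespace Profile

variable {N A : Type*}

/-- The top-shift profile `R^{x,y}`. -/
noncomputable def topShift (R : Profile N A) (x y : A) : Profile N A :=
  fun i => (R i).topShift x y

/-- Relabelling alternatives in every voter's preference by a permutation `σ`. -/
def map (σ : Equiv.Perm A) (R : Profile N A) : Profile N A := fun i => (R i).map σ

end Profile

/-- `nwins R x y` is `n(x,y,R)`, the number of voters strictly preferring `x` to `y`. -/
noncomputable def nwins {N A : Type*} (R : Profile N A) (x y : A) : ℕ :=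
  Nat.card {i // (R i).strict x y}

/-- The set of Condorcet winners of `R`. -/
def CW {N A : Type*} (R : Profile N A) : Set A :=
  {x | ∀ y, y ≠ x → nwins R y x ≤ nwins R x y}

/-- Condorcet consistency of a social decision rule. -/
def CondorcetConsistent {N A : Type*} (C : Profile N A → Set A) : Prop :=
  ∀ R : Profile N A, (CW R).Nonempty → C R = CW R

/-- The nice set `N_C(R)`: alternatives selected each time they are top-shifted with any
other alternative. -/
def niceSet {N A : Type*} (C : Profile N A → Set A) (R : Profile N A) : Set A :=
  {x | ∀ y, y ≠ x → x ∈ C (R.topShift x y)}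

/-- Weak top consistency (WTC). -/
def WeakTopConsistency {N A : Type*} (C : Profile N A → Set A) : Prop :=
  ∀ R : Profile N A, niceSet C R ⊆ C R

/-- Top consistency (TC). -/
def TopConsistency {N A : Type*} (C : Profile N A → Set A) : Prop :=
  ∀ R : Profile N A, (niceSet C R).Nonempty → C R = niceSet C R

/-- A 2-profile: two alternatives are unanimously strictly preferred to all others. -/
def IsTwoProfile {N A : Type*} (R : Profile N A) : Prop :=
  ∃ x y : A, x ≠ y ∧
    ∀ z, z ≠ x → z ≠ y → ∀ i, (R i).strict x z ∧ (R i).strict y z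

/-- Top anonymity (TA). -/
def TopAnonymity {N A : Type*} (C : Profile N A → Set A) : Prop :=
  ∀ R : Profile N A, IsTwoProfile R → ∀ π : Equiv.Perm N, C (fun i => R (π i)) = C R

/-- Top neutrality (TN). -/
def TopNeutrality {N A : Type*} (C : Profile N A → Set A) : Prop :=
  ∀ R : Profile N A, IsTwoProfile R → ∀ σ : Equiv.Perm A, C (Profile.map σ R) = σ '' (C R)

/-- Top symmetry (TS): top anonymity and top neutrality. -/
def TopSymmetry {N A : Type*} (C : Profile N A → Set A) : Prop :=
  TopAnonymity C ∧ TopNeutrality C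

/-- `Improves R Q x z`, i.e. `R ▷^{x,z} Q`: `Q` is an additional support of `x`
against `z` from `R` to `Q`. -/
def Improves {N A : Type*} (R Q : Profile N A) (x z : A) : Prop :=
  (∀ i w, ((R i).strict x w → (Q i).strict x w) ∧ ((R i).indiff x w → (Q i).rel x w)) ∧
  ∃ i, (R i).rel z x ∧ (Q i).strict x z

/-- Top monotonicity (TM). -/
def TopMonotonicity {N A : Type*} (C : Profile N A → Set A) : Prop :=
  ∀ (R Q : Profile N A) (x y z : A), x ≠ y → z ≠ x →
    x ∈ C (R.topShift x y) → Improves R Q x z →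
    x ∈ C (Q.topShift x y) ∧ z ∉ C (Q.topShift x y)

/-- Top rationality (TR). -/
def TopRationality {N A : Type*} (C : Profile N A → Set A) : Prop :=
  ∀ (R : Profile N A) (x y : A), x ≠ y → (C (R.topShift x y) ∩ {x, y}).Nonempty

/-- Maskin monotonicity (MM). -/
def MaskinMonotonic {N A : Type*} (C : Profile N A → Set A) : Prop :=
  ∀ (R Q : Profile N A) (x : A), x ∈ C R →
    (∀ i y, ((R i).strict x y → (Q i).strict x y) ∧ ((R i).indiff x y → (Q i).rel x y)) →
    x ∈ C Q

theorem WeakOrd.topShift_strict_of_mem {A : Type*} (r : WeakOrd A) {x y a b : A}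
    (ha : a = x ∨ a = y) (hb : b = x ∨ b = y) :
    (r.topShift x y).strict a b ↔ r.strict a b := by
  simp [WeakOrd.strict, WeakOrd.topShift, ha, hb]

theorem WeakOrd.not_topShift_strict {A : Type*} (r : WeakOrd A) {x y a b : A}
    (ha : ¬ (a = x ∨ a = y)) (hb : b = x ∨ b = y) :
    ¬ (r.topShift x y).strict a b := by
  simp [WeakOrd.strict, WeakOrd.topShift, ha, hb]

theorem nwins_topShift_of_mem {N A : Type*} (R : Profile N A) {x y a b : A}
    (ha : a = x ∨ a = y) (hb : b = x ∨ b = y) :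
    nwins (R.topShift x y) a b = nwins R a b := by
  simp only [nwins, Profile.topShift, WeakOrd.topShift_strict_of_mem _ ha hb]

theorem nwins_topShift_eq_zero {N A : Type*} (R : Profile N A) {x y a b : A}
    (ha : ¬ (a = x ∨ a = y)) (hb : b = x ∨ b = y) :
    nwins (R.topShift x y) a b = 0 := by
  simp [nwins, Profile.topShift, WeakOrd.not_topShift_strict _ ha hb]

theorem mem_CW_topShift {N A : Type*} (R : Profile N A) {x y a : A}
    (ha : a = x ∨ a = y) (h : ∀ b, b = x ∨ b = y → nwins R b a ≤ nwins R a b) :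
    a ∈ CW (R.topShift x y) := by
  intro b _
  by_cases hb : b = x ∨ b = y
  · rw [nwins_topShift_of_mem R hb ha, nwins_topShift_of_mem R ha hb]
    exact h b hb
  · simp [nwins_topShift_eq_zero R hb ha]

theorem CW_topShift_nonempty {N A : Type*} (R : Profile N A) (x y : A) :
    (CW (R.topShift x y)).Nonempty := by
  rcases le_total (nwins R y x) (nwins R x y) with h | h
  · exact ⟨x, mem_CW_topShift R (.inl rfl) (by rintro b (rfl | rfl) <;> simp [h])⟩
  · exact ⟨y, mem_CW_topShift R (.inr rfl) (by rintro b (rfl | rfl) <;> simp [h])⟩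

theorem niceSet_subset_CW {N A : Type*} {C : Profile N A → Set A}
    (hCC : CondorcetConsistent C) (R : Profile N A) : niceSet C R ⊆ CW R := by
  intro x hx y hyx
  have hmem := hx y hyx
  rw [hCC _ (CW_topShift_nonempty R x y)] at hmem
  have h := hmem y hyx
  rwa [nwins_topShift_of_mem R (.inr rfl) (.inl rfl),
    nwins_topShift_of_mem R (.inl rfl) (.inr rfl)] at h

/-- For every Condorcet-consistent SDR `C` and every profile `R`,
the nice set is contained in the set of Condorcet winners; in particular, if the
nice set is nonempty then so is the set of Condorcet winners. -/
theorem stmt_1 {N A : Type*} [Fintype N] [Fintype A]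
    (hN : 2 ≤ Fintype.card N) (hA : 3 ≤ Fintype.card A)
    (C : Profile N A → Set A) (hCne : ∀ R, (C R).Nonempty)
    (hCC : CondorcetConsistent C) :
    ∀ R : Profile N A, niceSet C R ⊆ CW R ∧
      ((niceSet C R).Nonempty → (CW R).Nonempty) := by
  intro R
  exact ⟨niceSet_subset_CW hCC R, fun h => h.mono (niceSet_subset_CW hCC R)⟩
end

section
/- If an SDR C satisfies top monotonicity (TM) and top rationality (TR), then for every profile R and all distinct alternatives x,y, the winning set of the top-shift profile is contained in the top pair: C(R^{x,y}) ⊆ {x,y}. -/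
namespace WeakOrd

variable {A : Type*}

theorem ext_rel {r s : WeakOrd A} (h : ∀ a b, r.rel a b ↔ s.rel a b) : r = s := by
  obtain ⟨r, _, _⟩ := r
  obtain ⟨s, _, _⟩ := s
  obtain rfl : r = s := funext₂ fun a b => propext (h a b)
  rfl

open Classical in
/-- The weak order obtained from `r` by moving `x` and `y` strictly below all other
alternatives, preserving the relative ranking of `x` and `y` and of the rest. -/
noncomputable def bottomShift (r : WeakOrd A) (x y : A) : WeakOrd A where
  rel a b :=
    if a = x ∨ a = y then (if b = x ∨ b = y then r.rel a b else False)
    else if b = x ∨ b = y then True else r.rel a b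
  total := by
    intro a b
    by_cases ha : a = x ∨ a = y <;> by_cases hb : b = x ∨ b = y <;>
      simp [ha, hb, r.total a b]
  trans := by
    intro a b c hab hbc
    by_cases ha : a = x ∨ a = y <;> by_cases hb : b = x ∨ b = y <;>
      by_cases hc : c = x ∨ c = y <;> simp_all <;>
      exact r.trans _ _ _ hab hbc

theorem topShift_comm (r : WeakOrd A) (x y : A) : r.topShift x y = r.topShift y x :=
  ext_rel fun a b => by
    grind [topShift]

theorem topShift_topShift (r : WeakOrd A) (x y : A) :
    (r.topShift x y).topShift x y = r.topShift x y :=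
  ext_rel fun a b => by
    by_cases ha : a = x ∨ a = y <;> by_cases hb : b = x ∨ b = y <;> simp [topShift, ha, hb]

theorem topShift_bottomShift (r : WeakOrd A) (x y : A) :
    (r.bottomShift x y).topShift x y = r.topShift x y :=
  ext_rel fun a b => by
    by_cases ha : a = x ∨ a = y <;> by_cases hb : b = x ∨ b = y <;>
      simp only [topShift, bottomShift, ha, hb, if_true, if_false]

end WeakOrd

/-- Raising `x` and `y` from the bottom to the top supports `x` against any third alternative. -/
theorem improves_bottomShift_topShift {N A : Type*} [Nonempty N] (R : Profile N A)
    {x y z : A} (hzx : z ≠ x) (hzy : z ≠ y) :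
    Improves (fun i => (R i).bottomShift x y) (R.topShift x y) x z := by
  refine ⟨fun i w => ?_, Classical.arbitrary N, ?_⟩
  · by_cases hw : w = x ∨ w = y <;>
      simp +contextual [WeakOrd.strict, WeakOrd.indiff, Profile.topShift, WeakOrd.topShift,
        WeakOrd.bottomShift, hw]
  · simp [WeakOrd.strict, Profile.topShift, WeakOrd.topShift, WeakOrd.bottomShift, hzx, hzy]

/-- Under top monotonicity, if `x` wins at a profile top-shifting `x` and `y`, then no third
alternative wins there. -/
theorem TopMonotonicity.subset_pair {N A : Type*} [Nonempty N] {C : Profile N A → Set A}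
    (hTM : TopMonotonicity C) {R : Profile N A} {x y : A} (hxy : x ≠ y)
    (hx : x ∈ C (R.topShift x y)) : C (R.topShift x y) ⊆ {x, y} := by
  intro z hz
  by_contra h
  obtain ⟨hzx, hzy⟩ : z ≠ x ∧ z ≠ y := by simpa using h
  have hbot : Profile.topShift (fun i => (R i).bottomShift x y) x y = R.topShift x y :=
    funext fun i => (R i).topShift_bottomShift x y
  have htop : (R.topShift x y).topShift x y = R.topShift x y :=
    funext fun i => (R i).topShift_topShift x y
  have key := (hTM _ _ x y z hxy hzx (hbot ▸ hx) (improves_bottomShift_topShift R hzx hzy)).2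
  rw [htop] at key
  exact key hz

/-- If an SDR satisfies TM and TR, then the winning set of any
top-shift profile is contained in the top pair. -/
theorem stmt_3 {N A : Type*} [Fintype N] [Fintype A]
    (hN : 2 ≤ Fintype.card N) (hA : 3 ≤ Fintype.card A)
    (C : Profile N A → Set A) (hCne : ∀ R, (C R).Nonempty)
    (hTM : TopMonotonicity C) (hTR : TopRationality C) :
    ∀ (R : Profile N A) (x y : A), x ≠ y →
      C (R.topShift x y) ⊆ {x, y} := by
  intro R x y hxy
  have : Nonempty N := Fintype.card_pos_iff.mp (by omega)
  obtain ⟨w, hw, rfl | rfl⟩ := hTR R x y hxy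
  · exact hTM.subset_pair hxy hw
  · have hcomm : R.topShift x w = R.topShift w x := funext fun i => (R i).topShift_comm x w
    rw [hcomm] at hw ⊢
    rw [Set.pair_comm]
    exact hTM.subset_pair hxy.symm hw
end
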